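/- Let q ≥ 3 be a power of an odd prime, let m > 2 be even, n = (q^m−1)/2, and let a ≥ 1, b ≥ 1 be integers with 1 ≤ a+b ≤ q−1 and ⌈(q−a−2)/2⌉ ≥ 1. Set δ̃′ = a(q^{m−1}+q^{m−2}) + b·q^{m−2} − 1 and δ = ⌈(δ̃′+1)/2⌉. Then the negacyclic BCH code C_{(n,−1,δ,0)} over F_q has length n, minimum distance at least δ, and dimension k = Σ_{t=0}^{m/2} (m/(m−t)) binom(m−t, t) Σ_{j=0}^{t} binom(t, j) ⌊(q−a−b)/2⌋^j ⌈(q−a−b)/2⌉^{t−j} φ(t,j) + κ·m, where κ = 1 if b is even and κ = 0 if b is odd, and where, writing E(t) = Σ_{i=0}^{m/2−t} binom(m−2t, 2i) ⌈(q−a−2)/2⌉^{2i} ⌊(q−a)/2⌋^{m−2t−2i} and O(t) = Σ_{i=0}^{m/2−t−1} binom(m−2t, 2i+1) ⌈(q−a−2)/2⌉^{2i+1} ⌊(q−a)/2⌋^{m−2t−2i−1}: if a is odd then φ(t,j) = E(t) when t and j have opposite parity and φ(t,j) = O(t) when t and j have the same parity; if a is even then φ(t,j) = E(t) when j is odd and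 φ(t,j) = O(t) when j is even. -/

import Mathlib

open Finset

/-- The `q`-cyclotomic coset of `i` modulo `N`, as a subset of `ZMod N`. -/
def qCoset (q N i : ℕ) : Set (ZMod N) :=
  Set.range fun j : ℕ => (i : ZMod N) * (q : ZMod N) ^ j

/-- The odd `q`-cyclotomic coset leaders modulo `N`. -/
noncomputable def oddLeaders (q N : ℕ) : Finset ℕ := by
  classical
  exact (Finset.range N).filter fun s => Odd s ∧ ∀ j : ℕ, s ≤ (s * q ^ j) % N

/-- `x` is the `i`-th largest element of the finite set `S` (1-indexed). -/
def IsIthLargest (S : Finset ℕ) (i x : ℕ) : Prop :=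
  x ∈ S ∧ (S.filter fun y => x ≤ y).card = i

/-- Evaluation of the polynomial with coefficient vector `c` at the point `x`
of an extension field. -/
noncomputable def evalAt (F : Type*) {E : Type*} [Field F] [Field E] [Algebra F E]
    (n : ℕ) (x : E) : (Fin n → F) →ₗ[F] E where
  toFun c := ∑ j : Fin n, c j • x ^ (j : ℕ)
  map_add' a b := by simp [add_smul, Finset.sum_add_distrib]
  map_smul' r a := by simp [Finset.smul_sum, smul_smul]

/-- The negacyclic BCH code `C_(n,-1,δ,b)`: all words whose polynomial vanishes at
`γ^(1+2i)` for `b ≤ i ≤ b+δ-2`, where `γ` is a primitive `2n`-th root of unity. -/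
noncomputable def negaBCH (F : Type*) {E : Type*} [Field F] [Field E] [Algebra F E]
    (n : ℕ) (γ : E) (δ b : ℕ) : Submodule F (Fin n → F) :=
  ⨅ i ∈ Finset.Icc b (b + δ - 2), LinearMap.ker (evalAt F n (γ ^ (1 + 2 * i)))

/-- The cyclic BCH code `C_(n,1,δ,b)`: all words whose polynomial vanishes at
`β^i` for `b ≤ i ≤ b+δ-2`, where `β` is a primitive `n`-th root of unity. -/
noncomputable def cyclicBCH (F : Type*) {E : Type*} [Field F] [Field E] [Algebra F E]
    (n : ℕ) (β : E) (δ b : ℕ) : Submodule F (Fin n → F) :=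
  ⨅ i ∈ Finset.Icc b (b + δ - 2), LinearMap.ker (evalAt F n (β ^ i))

/-- The dual code under the standard inner product. -/
def dualCode {F : Type*} [Field F] {n : ℕ} (C : Submodule F (Fin n → F)) :
    Submodule F (Fin n → F) where
  carrier := {y | ∀ c ∈ C, ∑ j, y j * c j = 0}
  add_mem' := by
    intro a b ha hb c hc
    simp only [Set.mem_setOf_eq] at *
    simp [Pi.add_apply, add_mul, Finset.sum_add_distrib, ha c hc, hb c hc]
  zero_mem' := by intro c hc; simp
  smul_mem' := by
    intro r y hy c hc
    simp only [Set.mem_setOf_eq] at *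
    simp [Pi.smul_apply, smul_eq_mul, mul_assoc, ← Finset.mul_sum, hy c hc]

/-- The extended code of a code of length `n`. -/
def extendedCode {F : Type*} [Field F] {n : ℕ} (C : Submodule F (Fin n → F)) :
    Submodule F (Fin (n + 1) → F) where
  carrier := {x | (fun j : Fin n => x j.castSucc) ∈ C ∧ ∑ i, x i = 0}
  add_mem' := by
    intro a b ha hb
    exact ⟨C.add_mem ha.1 hb.1, by simp [Finset.sum_add_distrib, ha.2, hb.2]⟩
  zero_mem' := ⟨C.zero_mem, by simp⟩
  smul_mem' := by
    intro r x hx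
    exact ⟨C.smul_mem r hx.1, by simp [← Finset.mul_sum, hx.2]⟩

/-- Hamming weight of a word. -/
noncomputable def hWt {F : Type*} [Field F] {n : ℕ} (c : Fin n → F) : ℕ := by
  classical exact hammingNorm c

/-- `d` is the minimum Hamming distance of the code `C`. -/
def minDistIs {F : Type*} [Field F] {n : ℕ} (C : Submodule F (Fin n → F)) (d : ℕ) : Prop :=
  IsLeast {w : ℕ | ∃ c ∈ C, c ≠ 0 ∧ hWt c = w} d

section Coding

open Polynomial

variable {F E : Type*} [Field F] [Field E] [Algebra F E]

theorem mem_range_algebraMap_of_pow_card_eq_self [Fintype F] {x : E}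
    (h : x ^ Fintype.card F = x) : x ∈ Set.range (algebraMap F E) := by
  have hprod : (∏ a : F, (X - C a)) = (X ^ Fintype.card F - X : F[X]) := by
    have hroots := FiniteField.roots_X_pow_card_sub_X F
    have hdeg := FiniteField.X_pow_card_sub_X_natDegree_eq F (Fintype.one_lt_card (α := F))
    have hmonic : (X ^ Fintype.card F - X : F[X]).Monic :=
      monic_X_pow_sub (by simpa using Fintype.one_lt_card (α := F))
    have := prod_multiset_X_sub_C_of_monic_of_roots_card_eq hmonic
      (by rw [hroots, hdeg]; simp)
    rw [hroots] at this
    exact this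
  have h0 := congrArg (aeval x) hprod
  rw [map_prod] at h0
  simp only [map_sub, aeval_X, aeval_C, map_pow, h, sub_self] at h0
  obtain ⟨a, -, ha⟩ := Finset.prod_eq_zero_iff.1 h0
  exact ⟨a, (sub_eq_zero.1 ha).symm⟩

theorem evalAt_eq_aeval (n : ℕ) (x : E) (c : Fin n → F) :
    evalAt F n x c = aeval x ((degreeLTEquiv F n).symm c : F[X]) := by
  simp [evalAt, degreeLTEquiv, Algebra.smul_def, aeval_monomial]

theorem evalAt_pow_card [Fintype F] (n j : ℕ) (x : E) (c : Fin n → F) :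
    evalAt F n (x ^ Fintype.card F ^ j) c = evalAt F n x c ^ Fintype.card F ^ j := by
  induction j with
  | zero => simp
  | succ j ih =>
    rw [pow_succ, pow_mul, pow_mul, ← ih, evalAt_eq_aeval, evalAt_eq_aeval]
    exact aeval_algHom_apply (FiniteField.frobeniusAlgHom F E) _ _

/-- A code defined over `F` by a Frobenius-stable set of zeros has codimension equal to the
number of those zeros. -/
theorem finrank_of_frobenius_stable_zeros [Fintype F] {n : ℕ} (S : Finset E)
    (hS : ∀ x ∈ S, x ^ Fintype.card F ∈ S) (hn : S.card ≤ n) (C : Submodule F (Fin n → F))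
    (hC : ∀ c, c ∈ C ↔ ∀ x ∈ S, evalAt F n x c = 0) :
    Module.finrank F C = n - S.card := by
  classical
  set φ := FiniteField.frobeniusAlgHom F E
  have hφ : ∀ x, φ x = x ^ Fintype.card F := fun x => rfl
  have hinj : Function.Injective φ := φ.toRingHom.injective
  have himg : S.image φ = S := by
    apply Finset.eq_of_subset_of_card_le
    · intro y hy
      obtain ⟨x, hx, rfl⟩ := Finset.mem_image.1 hy
      exact hS x hx
    · rw [Finset.card_image_of_injective _ hinj]
  set P : E[X] := ∏ x ∈ S, (X - Polynomial.C x) with hP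
  have hPmap : P.map (φ : E →+* E) = P := by
    rw [hP, Polynomial.map_prod]
    conv_rhs => rw [← himg]
    rw [Finset.prod_image (fun _ _ _ _ h => hinj h)]
    simp
  have hlift : P ∈ lifts (algebraMap F E) := by
    rw [lifts_iff_coeff_lifts]
    intro k
    apply mem_range_algebraMap_of_pow_card_eq_self
    have := congrArg (fun p => p.coeff k) hPmap
    rw [coeff_map] at this
    exact this
  obtain ⟨g, hg, hgdeg, hgm⟩ :=
    lifts_and_natDegree_eq_and_monic hlift (monic_prod_of_monic _ _ fun x _ => monic_X_sub_C x)
  have hdeg : g.natDegree = S.card := by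
    rw [hgdeg, hP, natDegree_prod_of_monic _ _ fun x _ => monic_X_sub_C x]
    simp
  have hdvd : ∀ p : F[X], (∀ x ∈ S, aeval x p = 0) ↔ g ∣ p := by
    intro p
    constructor
    · intro h
      rw [← map_dvd_map' (algebraMap F E), hg, hP]
      apply Finset.prod_dvd_of_coprime
      · intro x _ y _ hxy
        exact isCoprime_X_sub_C_of_isUnit_sub (sub_ne_zero.2 hxy).isUnit
      · intro x hx
        rw [dvd_iff_isRoot, IsRoot, eval_map_algebraMap]
        exact h x hx
    · rintro ⟨r, rfl⟩ x hx
      rw [map_mul, ← eval_map_algebraMap, hg, hP, eval_prod, Finset.prod_eq_zero hx (by simp),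
        zero_mul]
  set d := S.card
  let L : degreeLT F (n - d) →ₗ[F] (Fin n → F) :=
    (degreeLTEquiv F n).toLinearMap ∘ₗ
      LinearMap.codRestrict (degreeLT F n) (LinearMap.mulLeft F g ∘ₗ (degreeLT F (n - d)).subtype)
        (fun p => by
          have hp := mem_degreeLT.1 p.2
          rw [mem_degreeLT]
          by_cases h0 : (p : F[X]) = 0
          · simp only [LinearMap.comp_apply, Submodule.subtype_apply, LinearMap.mulLeft_apply, h0,
              mul_zero, degree_zero]
            exact WithBot.bot_lt_coe n
          · simp only [LinearMap.comp_apply, Submodule.subtype_apply, LinearMap.mulLeft_apply]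
            have h1 := (natDegree_lt_iff_degree_lt h0).2 hp
            rw [← natDegree_lt_iff_degree_lt (mul_ne_zero hgm.ne_zero h0),
              natDegree_mul hgm.ne_zero h0, hdeg]
            omega)
  have hLinj : Function.Injective L := by
    refine (degreeLTEquiv F n).injective.comp ?_
    intro p r h
    have := congrArg Subtype.val h
    exact Subtype.ext (mul_left_cancel₀ hgm.ne_zero this)
  have hLrange : LinearMap.range L = C := by
    ext c
    rw [hC]
    simp only [evalAt_eq_aeval]
    rw [hdvd]
    constructor
    · rintro ⟨p, rfl⟩
      refine ⟨p, ?_⟩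
      simp [L]
    · rintro ⟨r, hr⟩
      have hc := mem_degreeLT.1 ((degreeLTEquiv F n).symm c).2
      have hmem : r ∈ degreeLT F (n - d) := by
        rw [mem_degreeLT]
        by_cases h0 : r = 0
        · rw [h0, degree_zero]
          exact WithBot.bot_lt_coe _
        · rw [hr, ← natDegree_lt_iff_degree_lt (mul_ne_zero hgm.ne_zero h0),
            natDegree_mul hgm.ne_zero h0, hdeg] at hc
          rw [← natDegree_lt_iff_degree_lt h0]
          omega
      refine ⟨⟨r, hmem⟩, ?_⟩
      apply (degreeLTEquiv F n).symm.injective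
      apply Subtype.ext
      rw [hr]
      simp [L]
  rw [← hLrange, LinearMap.finrank_range_of_inj hLinj, (degreeLTEquiv F (n - d)).finrank_eq]
  simp

/-- The BCH bound for negacyclic codes. -/
theorem le_hWt_of_mem_negaBCH {n δ : ℕ} (hδ : 2 ≤ δ) {γ : E} (hγ : IsPrimitiveRoot γ (2 * n))
    {c : Fin n → F} (hc : c ∈ negaBCH F n γ δ 0) (hc0 : c ≠ 0) : δ ≤ hWt c := by
  classical
  by_contra! hlt
  set s := Finset.univ.filter fun j => c j ≠ 0
  have hs : s.card = hWt c := by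
    simp only [hWt, hammingNorm, s]
  set e := s.equivFin.symm
  have hn : n ≠ 0 := by
    rintro rfl
    exact hc0 (Subsingleton.elim _ _)
  have hγ0 : γ ≠ 0 := hγ.ne_zero (by omega)
  have hzero : ∀ i < s.card, ∑ j : Fin s.card,
      (algebraMap F E (c (e j)) * γ ^ (e j : ℕ)) * ((γ ^ 2) ^ (e j : ℕ)) ^ i = 0 := by
    intro i hi
    have hmem : evalAt F n (γ ^ (1 + 2 * i)) c = 0 := by
      simp only [negaBCH, Submodule.mem_iInf] at hc
      exact hc i (by simp; omega)
    have h1 : evalAt F n (γ ^ (1 + 2 * i)) c = ∑ j ∈ s, c j • (γ ^ (1 + 2 * i)) ^ (j : ℕ) := by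
      simp only [evalAt, LinearMap.coe_mk, AddHom.coe_mk]
      symm
      apply Finset.sum_subset (Finset.subset_univ _)
      intro j _ hj
      have : c j = 0 := by simpa [s] using hj
      simp [this]
    rw [h1, ← Finset.sum_coe_sort, ← e.sum_comp] at hmem
    rw [← hmem]
    refine Finset.sum_congr rfl fun j _ => ?_
    rw [Algebra.smul_def]
    ring
  have hinj : Function.Injective fun j : Fin s.card => (γ ^ 2) ^ (e j : ℕ) := by
    intro j k hjk
    have := (hγ.pow (by omega) rfl).pow_inj (e j).1.2 (e k).1.2 hjk
    exact e.injective (Subtype.ext (Fin.ext this))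
  have := Matrix.eq_zero_of_forall_pow_sum_mul_pow_eq_zero hinj fun i => hzero i i.2
  have hpos : 0 < s.card := by
    rw [hs, hWt]
    exact hammingNorm_pos_iff.2 hc0
  have h2 := congrFun this ⟨0, hpos⟩
  have h3 : c (e ⟨0, hpos⟩) ≠ 0 := (Finset.mem_filter.1 (e ⟨0, hpos⟩).2).2
  simp [hγ0, h3] at h2

open scoped Classical in
theorem finrank_negaBCH [Fintype F] {n m δ : ℕ} (hδ : 2 ≤ δ) (hn : 0 < n) (hm : 0 < m)
    (hq : Odd (Fintype.card F)) (hqm : Fintype.card F ^ m ≡ 1 [MOD 2 * n]) {γ : E}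
    (hγ : IsPrimitiveRoot γ (2 * n)) :
    Module.finrank F (negaBCH F n γ δ 0) = ((range (2 * n)).filter fun s =>
      Odd s ∧ ∀ j, 2 * δ - 1 ≤ s * Fintype.card F ^ j % (2 * n)).card := by
  set q := Fintype.card F
  set Z := (range (2 * n)).filter fun s => Odd s ∧ ∃ j, s * q ^ j % (2 * n) < 2 * δ - 1
  have hmod : ∀ s j, γ ^ (s * q ^ j % (2 * n)) = (γ ^ s) ^ q ^ j := by
    intro s j
    rw [← pow_mul]
    conv_lhs => rw [hγ.eq_orderOf, pow_mod_orderOf]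
  have hodd : ∀ s j, Odd s → Odd (s * q ^ j % (2 * n)) := by
    intro s j hs
    have h := hs.mul (hq.pow (n := j))
    rw [Nat.odd_iff] at h ⊢
    rw [Nat.mod_mod_of_dvd _ (Dvd.intro _ rfl), h]
  have hcount : (range (2 * n)).filter Odd = (range n).image fun i => 2 * i + 1 := by
    ext x
    simp only [mem_filter, mem_range, mem_image]
    constructor
    · rintro ⟨h, k, rfl⟩
      exact ⟨k, by omega, rfl⟩
    · rintro ⟨k, h, rfl⟩
      exact ⟨by omega, k, rfl⟩
  have hoddcard : ((range (2 * n)).filter Odd).card = n := by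
    rw [hcount, card_image_of_injective _ (fun a b h => by simpa using h), card_range]
  have hsplit : ((range (2 * n)).filter fun s =>
      Odd s ∧ ∀ j, 2 * δ - 1 ≤ s * q ^ j % (2 * n)).card + Z.card = n := by
    have := ((range (2 * n)).filter Odd).card_filter_add_card_filter_not
      (fun s => ∀ j, 2 * δ - 1 ≤ s * q ^ j % (2 * n))
    rw [hoddcard, filter_filter, filter_filter] at this
    simp only [not_forall, not_le] at this
    exact this
  have hinj : Set.InjOn (fun s => γ ^ s) (Z : Set ℕ) := by
    intro s hs t ht h
    exact hγ.pow_inj (mem_range.1 (mem_filter.1 hs).1) (mem_range.1 (mem_filter.1 ht).1) h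
  have hcard : (Z.image fun s => γ ^ s).card = Z.card := card_image_of_injOn hinj
  rw [finrank_of_frobenius_stable_zeros (Z.image fun s => γ ^ s) ?_ (by omega) _ ?_, hcard]
  · omega
  · intro x hx
    obtain ⟨s, hs, rfl⟩ := mem_image.1 hx
    obtain ⟨-, hso, j, hj⟩ := mem_filter.1 hs
    refine mem_image.2 ⟨s * q ^ 1 % (2 * n), mem_filter.2
      ⟨mem_range.2 (Nat.mod_lt _ (by omega)), hodd _ _ hso, ?_⟩, by
        rw [hmod, pow_one]⟩
    refine ⟨j + (m - 1), ?_⟩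
    have h : s * q ^ 1 * q ^ (j + (m - 1)) ≡ s * q ^ j [MOD 2 * n] := by
      have := hqm.mul_left (s * q ^ j)
      rwa [mul_one, mul_assoc, ← pow_add, show j + m = 1 + (j + (m - 1)) by omega, pow_add,
        ← mul_assoc] at this
    have h' := ((Nat.mod_modEq (s * q ^ 1) (2 * n)).mul_right (q ^ (j + (m - 1)))).trans h
    rwa [h']
  · intro c
    simp only [negaBCH, Submodule.mem_iInf, LinearMap.mem_ker, mem_image, forall_exists_index,
      and_imp, forall_apply_eq_imp_iff₂]
    constructor
    · intro h s hs
      obtain ⟨-, hso, j, hj⟩ := mem_filter.1 hs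
      obtain ⟨i, hi⟩ := hodd s j hso
      have := h i (by simp; omega)
      rw [add_comm 1, ← hi, hmod, evalAt_pow_card] at this
      exact pow_eq_zero_iff (pow_ne_zero _ Fintype.card_ne_zero) |>.1 this
    · intro h i hi
      have h1 := h ((1 + 2 * i) * q ^ 0 % (2 * n)) (mem_filter.2
        ⟨mem_range.2 (Nat.mod_lt _ (by omega)), hodd _ _ ⟨i, by ring⟩, 0, ?_⟩)
      · rwa [hmod, pow_zero, pow_one] at h1
      · have := Nat.mod_le (1 + 2 * i) (2 * n)
        simp at hi ⊢
        omega

end Coding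

section Counting

theorem sum_range_two_mul_add_one {R : Type*} [AddCommMonoid R] (g : ℕ → R) (M : ℕ) :
    ∑ i ∈ range (2 * M + 1), g i =
      ∑ i ∈ range (M + 1), g (2 * i) + ∑ i ∈ range M, g (2 * i + 1) := by
  induction M with
  | zero => simp
  | succ M ih =>
    rw [show 2 * (M + 1) + 1 = 2 * M + 1 + 1 + 1 by ring, sum_range_succ, sum_range_succ, ih,
      sum_range_succ (fun i => g (2 * i)) (M + 1), sum_range_succ (fun i => g (2 * i + 1)) M,
      show 2 * M + 1 + 1 = 2 * (M + 1) by ring]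
    abel

theorem evenPart_add_oddPart (o e M : ℕ) :
    ((∑ i ∈ range (M + 1), (2 * M).choose (2 * i) * o ^ (2 * i) * e ^ (2 * M - 2 * i) : ℕ) : ℤ) +
      (∑ i ∈ range M, (2 * M).choose (2 * i + 1) * o ^ (2 * i + 1) * e ^ (2 * M - 2 * i - 1) : ℕ)
      = ((o : ℤ) + e) ^ (2 * M) := by
  rw [add_pow, sum_range_two_mul_add_one]
  push_cast
  simp only [← Nat.sub_sub]
  congr 1 <;> exact sum_congr rfl fun i _ => by ring

theorem evenPart_sub_oddPart (o e M : ℕ) :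
    ((∑ i ∈ range (M + 1), (2 * M).choose (2 * i) * o ^ (2 * i) * e ^ (2 * M - 2 * i) : ℕ) : ℤ) -
      (∑ i ∈ range M, (2 * M).choose (2 * i + 1) * o ^ (2 * i + 1) * e ^ (2 * M - 2 * i - 1) : ℕ)
      = ((e : ℤ) - o) ^ (2 * M) := by
  rw [show (e : ℤ) - o = -o + e by ring, add_pow, sum_range_two_mul_add_one, sub_eq_add_neg]
  push_cast
  rw [← sum_neg_distrib]
  congr 1
  · refine sum_congr rfl fun i _ => ?_
    rw [(even_two_mul i).neg_pow]
    ring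
  · refine sum_congr rfl fun i _ => ?_
    rw [(odd_two_mul_add_one i).neg_pow, ← Nat.sub_sub]
    ring

theorem two_mul_sum_parity (a t o' e' : ℕ) {ev od : ℕ} {s d : ℤ} (hs : (ev : ℤ) + od = s)
    (hd : (ev : ℤ) - od = d) :
    2 * ((∑ j ∈ range (t + 1), t.choose j * o' ^ j * e' ^ (t - j) *
      (if (if Odd a then (t + j) % 2 = 1 else j % 2 = 1) then ev else od) : ℕ) : ℤ) =
    s * ((o' : ℤ) + e') ^ t - d * ((-1) ^ a * ((e' : ℤ) - o')) ^ t := by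
  have h2 : ∀ j, 2 * (((if (if Odd a then (t + j) % 2 = 1 else j % 2 = 1) then ev else od) : ℕ) : ℤ)
      = s - d * ((-1) ^ a) ^ t * (-1) ^ j := by
    intro j
    subst hs hd
    rw [← pow_mul, mul_assoc, ← pow_add]
    split_ifs with h1 h2 h2
    · have : Odd (a * t + j) := by
        rw [← Nat.odd_iff] at h2
        rw [Nat.odd_add, Nat.odd_mul] at *
        tauto
      rw [this.neg_one_pow]; ring
    · have : Even (a * t + j) := by
        rw [← Nat.odd_iff, Nat.not_odd_iff_even] at h2
        rw [Nat.even_add, Nat.even_mul] at *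
        rw [← Nat.not_even_iff_odd] at h1
        tauto
      rw [this.neg_one_pow]; ring
    · have : Odd (a * t + j) := by
        rw [← Nat.odd_iff] at h2
        rw [Nat.not_odd_iff_even] at h1
        exact (h1.mul_right t).add_odd h2
      rw [this.neg_one_pow]; ring
    · have : Even (a * t + j) := by
        rw [← Nat.odd_iff, Nat.not_odd_iff_even] at h2
        rw [Nat.not_odd_iff_even] at h1
        exact (h1.mul_right t).add h2
      rw [this.neg_one_pow]; ring
  rw [mul_pow, show (e' : ℤ) - o' = -o' + e' by ring, add_pow, add_pow]
  push_cast [mul_sum]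
  rw [← sum_sub_distrib]
  refine sum_congr rfl fun j _ => ?_
  have := h2 j
  push_cast at this
  rw [mul_left_comm, this, neg_pow (o' : ℤ)]
  ring

section Lucas

variable {R : Type*} [CommRing R]

/-- The Fibonacci polynomials in two variables. -/
def fibPoly (P x : R) (n : ℕ) : R :=
  ∑ t ∈ range (n + 1), ((n - t).choose t : R) * P ^ (n - 2 * t) * x ^ t

theorem fibPoly_add_two (P x : R) (n : ℕ) :
    fibPoly P x (n + 2) = P * fibPoly P x (n + 1) + x * fibPoly P x n := by
  unfold fibPoly
  rw [sum_range_succ' _ (n + 2), sum_range_succ' (fun t => ((n + 1 - t).choose t : R) * _ * _),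
    sum_range_succ _ (n + 1), mul_add P, mul_sum, mul_sum,
    add_right_comm (∑ i ∈ range (n + 1), P * _), ← sum_add_distrib]
  congr 1
  · rw [show n + 2 - (n + 1 + 1) = 0 by omega, Nat.choose_zero_succ]
    simp only [Nat.cast_zero, zero_mul, add_zero]
    refine sum_congr rfl fun t ht => ?_
    have ht : t ≤ n := Nat.lt_succ_iff.1 (mem_range.1 ht)
    rw [show n + 2 - (t + 1) = n - t + 1 by omega, show n + 1 - (t + 1) = n - t by omega,
      Nat.choose_succ_succ, show n + 2 - 2 * (t + 1) = n - 2 * t by omega]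
    rcases Nat.lt_or_ge (2 * t) n with h | h
    · rw [show n - 2 * t = n + 1 - 2 * (t + 1) + 1 by omega]
      push_cast
      ring
    · rw [Nat.choose_eq_zero_of_lt (show n - t < t + 1 by omega)]
      push_cast
      ring
  · simp
    ring

theorem lucas_coeff (n t : ℕ) (ht : t ≤ n) :
    (n + 2) * (n + 2 - (t + 1)).choose (t + 1) / (n + 2 - (t + 1)) =
      (n + 2 - (t + 1)).choose (t + 1) + (n - t).choose t := by
  have h := Nat.add_one_mul_choose_eq (n - t) t
  rw [show n + 2 - (t + 1) = n - t + 1 by omega]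
  apply Nat.div_eq_of_eq_mul_left (by omega)
  rw [show n + 2 = (n - t + 1) + (t + 1) by omega, add_mul, add_mul]
  linarith

theorem lucas_eq_sum {P x : R} {T : ℕ → R} (h0 : T 0 = 2) (h1 : T 1 = P)
    (h : ∀ n, T (n + 2) = P * T (n + 1) + x * T n) (n : ℕ) :
    T (n + 2) = ∑ t ∈ range ((n + 2) / 2 + 1),
      (((n + 2) * (n + 2 - t).choose t / (n + 2 - t) : ℕ) : R) * P ^ (n + 2 - 2 * t) * x ^ t := by
  have key : ∀ n, T (n + 2) = fibPoly P x (n + 2) + x * fibPoly P x n ∧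
      T (n + 3) = fibPoly P x (n + 3) + x * fibPoly P x (n + 1) := by
    intro n
    induction n with
    | zero =>
      rw [h 1, h 0, h0, h1]
      simp [fibPoly, sum_range_succ]
      constructor <;> ring
    | succ n ih =>
      refine ⟨ih.2, ?_⟩
      rw [h (n + 2), ih.1, ih.2, fibPoly_add_two _ _ (n + 2), fibPoly_add_two _ _ n]
      ring
  rw [(key n).1]
  have hext : ∑ t ∈ range ((n + 2) / 2 + 1),
      (((n + 2) * (n + 2 - t).choose t / (n + 2 - t) : ℕ) : R) * P ^ (n + 2 - 2 * t) * x ^ t =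
    ∑ t ∈ range (n + 1 + 1),
      (((n + 2) * (n + 2 - t).choose t / (n + 2 - t) : ℕ) : R) * P ^ (n + 2 - 2 * t) * x ^ t := by
    apply sum_subset
    · intro t
      simp only [mem_range]
      omega
    · intro t _ ht
      rw [Nat.choose_eq_zero_of_lt (by simp at ht; omega)]
      simp
  rw [hext, fibPoly, fibPoly, sum_range_succ' _ (n + 1), sum_range_succ' _ (n + 2),
    sum_range_succ _ (n + 1), mul_sum, add_right_comm]
  congr 1
  · rw [show n + 2 - (n + 1 + 1) = 0 by omega, Nat.choose_zero_succ]
    simp only [Nat.cast_zero, zero_mul, add_zero]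
    rw [← sum_add_distrib]
    refine sum_congr rfl fun t ht => ?_
    rw [lucas_coeff n t (by simp at ht; omega), show n + 2 - 2 * (t + 1) = n - 2 * t by omega]
    push_cast
    ring
  · simp

theorem trace_pow_two_by_two (P r c : R) (n : ℕ) :
    (!![P, r; c, 0] ^ (n + 2)).trace = ∑ t ∈ range ((n + 2) / 2 + 1),
      (((n + 2) * (n + 2 - t).choose t / (n + 2 - t) : ℕ) : R) * P ^ (n + 2 - 2 * t) *
        (c * r) ^ t := by
  apply lucas_eq_sum (T := fun n => (!![P, r; c, 0] ^ n).trace)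
  · simp
  · simp
  · intro n
    have h2 : !![P, r; c, 0] ^ 2 = P • !![P, r; c, 0] + (c * r) • 1 := by
      ext i j
      fin_cases i <;> fin_cases j <;> simp [pow_two, Matrix.mul_apply, Fin.sum_univ_two] <;> ring
    rw [pow_add, h2, mul_add, Matrix.mul_smul, Matrix.mul_smul, mul_one, ← pow_succ,
      Matrix.trace_add, Matrix.trace_smul, Matrix.trace_smul, smul_eq_mul, smul_eq_mul]

end Lucas

section Transfer

variable {R ι κ : Type*} [CommRing R] [Fintype ι] [DecidableEq ι] [Fintype κ] [DecidableEq κ]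

theorem trace_mul_pow_comm (U : Matrix ι κ R) (V : Matrix κ ι R) (n : ℕ) :
    ((U * V) ^ (n + 1)).trace = ((V * U) ^ (n + 1)).trace := by
  have h : ∀ n, (U * V) ^ (n + 1) = U * ((V * U) ^ n * V) := by
    intro n
    induction n with
    | zero => simp
    | succ n ih => rw [pow_succ, ih, pow_succ]; simp only [Matrix.mul_assoc]
  rw [h, Matrix.trace_mul_comm, pow_succ]
  simp only [Matrix.mul_assoc]

theorem pow_apply_eq_sum_paths (M : Matrix ι ι R) (n : ℕ) (x y : ι) :
    (M ^ (n + 1)) x y = ∑ g : Fin n → ι, ∏ i : Fin (n + 1),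
      M ((Fin.cons x g : Fin (n + 1) → ι) i) ((Fin.snoc g y : Fin (n + 1) → ι) i) := by
  induction n generalizing x with
  | zero => simp [Fin.snoc]
  | succ n ih =>
    rw [pow_succ', Matrix.mul_apply, ← (Fin.consEquiv fun _ => ι).sum_comp, Fintype.sum_prod_type]
    refine sum_congr rfl fun z _ => ?_
    rw [ih, mul_sum]
    refine sum_congr rfl fun g _ => ?_
    rw [Fin.prod_univ_succ (n := n + 1)]
    simp only [Fin.consEquiv, Equiv.coe_fn_mk, ← Fin.cons_snoc_eq_snoc_cons, Fin.cons_zero,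
      Fin.cons_succ]

theorem trace_pow_eq_sum_cyclic (M : Matrix ι ι R) (n : ℕ) :
    (M ^ (n + 1)).trace = ∑ w : Fin (n + 1) → ι, ∏ i, M (w i) (w (i + 1)) := by
  rw [← (Fin.consEquiv fun _ => ι).sum_comp, Fintype.sum_prod_type, Matrix.trace]
  refine sum_congr rfl fun x _ => ?_
  rw [Matrix.diag_apply, pow_apply_eq_sum_paths]
  refine sum_congr rfl fun g _ => prod_congr rfl fun i _ => ?_
  congr 1
  induction i using Fin.lastCases with
  | last => simp [Fin.consEquiv]
  | cast i => simp [Fin.consEquiv]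

end Transfer

/-- Weighted count of cyclic words over `{0, …, q - 1}` all of whose letters are at least `a` and
in which every letter `a` is preceded by a letter that is at least `a + b`. -/
theorem sum_admissible_words {R : Type*} [CommRing R] {q a b : ℕ} (hb : 1 ≤ b) (ha : a < q)
    (f : ℕ → R) (n : ℕ) :
    ∑ w : Fin (n + 2) → Fin q, (if ∀ i, a < (w (i + 1) : ℕ) ∨ (w (i + 1) : ℕ) = a ∧ a + b ≤ w i
      then ∏ i, f (w i) else 0) =
    ∑ t ∈ range ((n + 2) / 2 + 1),
      (((n + 2) * (n + 2 - t).choose t / (n + 2 - t) : ℕ) : R) *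
        (∑ y ∈ Ico (a + 1) q, f y) ^ (n + 2 - 2 * t) *
        (f a * ∑ y ∈ Ico (a + b) q, f y) ^ t := by
  let U : Matrix (Fin q) (Fin 2) R :=
    Matrix.of fun x => ![1, if a + b ≤ (x : ℕ) then 1 else 0]
  let V : Matrix (Fin 2) (Fin q) R :=
    Matrix.of ![fun y => if a < (y : ℕ) then f y else 0, fun y => if (y : ℕ) = a then f y else 0]
  have hsum : ∀ g : ℕ → R, ∑ y : Fin q, g y = ∑ y ∈ range q, g y :=
    fun g => (sum_range g).symm
  have hfilter : ∀ c, (range q).filter (fun y => c ≤ y) = Ico c q := by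
    intro c
    ext y
    simp [and_comm]
  have hVU : V * U = !![∑ y ∈ Ico (a + 1) q, f y, ∑ y ∈ Ico (a + b) q, f y; f a, 0] := by
    ext i j
    fin_cases i <;> fin_cases j <;> simp [Matrix.mul_apply, U, V]
    · rw [hsum fun y => if a < y then f y else 0, ← sum_filter, ← hfilter]
      rfl
    · rw [hsum fun y => if a + b ≤ y then if a < y then f y else 0 else 0, ← sum_filter, hfilter]
      refine sum_congr rfl fun y hy => if_pos ?_
      have := mem_Ico.1 hy
      omega
    · rw [hsum fun y => if y = a then f y else 0]
      simp [ha]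
    · refine sum_eq_zero fun y _ => ?_
      split_ifs <;> first | rfl | omega
  rw [← trace_pow_two_by_two, ← hVU, ← trace_mul_pow_comm U V (n + 1), trace_pow_eq_sum_cyclic]
  refine sum_congr rfl fun w _ => ?_
  have hUV : ∀ x y, (U * V) x y =
      if a < (y : ℕ) ∨ (y : ℕ) = a ∧ a + b ≤ (x : ℕ) then f y else 0 := by
    intro x y
    simp only [Matrix.mul_apply, Fin.sum_univ_two]
    simp [U, V]
    split_ifs <;> first | omega | simp
  simp only [hUV]
  have hshift : ∏ i, f (w (i + 1)) = ∏ i, f (w i) :=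
    Equiv.prod_comp (Equiv.addRight (1 : Fin (n + 2))) fun i => f (w i)
  rw [prod_ite_zero, hshift]
  simp

/-- The number whose base-`q` digits, from the least significant one, are the letters of `w`. -/
def wordVal {q n : ℕ} (w : Fin n → Fin q) : ℕ :=
  ∑ i, (w i : ℕ) * q ^ (i : ℕ)

theorem wordVal_lt {q n : ℕ} (w : Fin n → Fin q) : wordVal w < q ^ n := by
  rw [wordVal, ← finFunctionFinEquiv_apply]
  exact (finFunctionFinEquiv w).2

theorem wordVal_injective (q n : ℕ) :
    Function.Injective (wordVal : (Fin n → Fin q) → ℕ) := by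
  intro w v h
  apply finFunctionFinEquiv.injective
  apply Fin.ext
  rwa [finFunctionFinEquiv_apply, finFunctionFinEquiv_apply]

theorem exists_wordVal_eq {q n s : ℕ} (hs : s < q ^ n) : ∃ w : Fin n → Fin q, wordVal w = s := by
  refine ⟨finFunctionFinEquiv.symm ⟨s, hs⟩, ?_⟩
  rw [wordVal, ← finFunctionFinEquiv_apply, Equiv.apply_symm_apply]

theorem odd_wordVal {q n : ℕ} (hq : Odd q) (w : Fin n → Fin q) :
    Odd (wordVal w) ↔ Odd (∑ i, (w i : ℕ)) := by
  rw [← Nat.not_even_iff_odd, ← Nat.not_even_iff_odd, not_iff_not, ← ZMod.natCast_eq_zero_iff_even,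
    ← ZMod.natCast_eq_zero_iff_even, wordVal]
  push_cast
  rw [ZMod.natCast_eq_one_iff_odd.2 hq]
  simp

/-- Rotating a word multiplies its value by `q` modulo `q ^ n - 1`. -/
theorem wordVal_rotate {q n : ℕ} (w : Fin (n + 1) → Fin q) :
    wordVal (fun i => w (i - 1)) ≡ wordVal w * q [MOD q ^ (n + 1) - 1] := by
  have hq : 0 < q := (w 0).pos
  have h1 : wordVal (fun i => w (i - 1)) =
      ∑ i : Fin (n + 1), (w i : ℕ) * q ^ ((i + 1 : Fin (n + 1)) : ℕ) := by
    rw [wordVal, ← Equiv.sum_comp (Equiv.addRight (1 : Fin (n + 1)))]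
    simp
  rw [h1, wordVal, sum_mul]
  refine Nat.ModEq.sum fun i _ => ?_
  rw [mul_assoc, ← pow_succ]
  apply Nat.ModEq.mul_left
  induction i using Fin.lastCases with
  | last =>
    rw [Fin.last_add_one, Fin.val_zero, pow_zero, Fin.val_last]
    exact (Nat.modEq_iff_dvd' (Nat.one_le_pow _ _ hq)).2 dvd_rfl
  | cast i => simp [Fin.val_succ]; rfl

open Fin.NatCast Fin.CommRing in
theorem wordVal_rotate_iterate {q n : ℕ} (w : Fin (n + 1) → Fin q) (j : ℕ) :
    wordVal (fun i : Fin (n + 1) => w (i - (j : Fin (n + 1)))) ≡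
      wordVal w * q ^ j [MOD q ^ (n + 1) - 1] := by
  induction j with
  | zero => simp; rfl
  | succ j ih =>
    have := (wordVal_rotate fun i : Fin (n + 1) => w (i - (j : Fin (n + 1)))).trans (ih.mul_right q)
    rw [pow_succ q j, ← mul_assoc]
    have hidx : (fun i : Fin (n + 1) => w (i - ((j + 1 : ℕ) : Fin (n + 1)))) =
        fun i => w (i - 1 - (j : Fin (n + 1))) := by
      funext i
      congr 1
      push_cast
      ring
    rw [hidx]
    exact this

theorem wordVal_const {q n : ℕ} (hq : 0 < q) :
    wordVal (fun _ : Fin n => (⟨q - 1, Nat.sub_lt hq one_pos⟩ : Fin q)) = q ^ n - 1 := by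
  have h := geom_sum_mul_of_one_le (Nat.succ_le_of_lt hq) n
  rw [← h, sum_mul, sum_range, wordVal]
  exact sum_congr rfl fun i _ => mul_comm _ _

open Fin.NatCast Fin.CommRing in
theorem wordVal_rotate_mod {q n : ℕ} {w : Fin (n + 1) → Fin q}
    (hw : wordVal w < q ^ (n + 1) - 1) (j : ℕ) :
    wordVal w * q ^ j % (q ^ (n + 1) - 1) =
      wordVal fun i : Fin (n + 1) => w (i - (j : Fin (n + 1))) := by
  have hq : 0 < q := (w 0).pos
  have hlt : wordVal (fun i : Fin (n + 1) => w (i - (j : Fin (n + 1)))) < q ^ (n + 1) - 1 := by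
    refine lt_of_le_of_ne (Nat.le_sub_one_of_lt (wordVal_lt _)) fun h => hw.ne ?_
    rw [← wordVal_const hq] at h ⊢
    have h' := wordVal_injective _ _ h
    congr 1
    ext i
    have := congrFun h' (i + (j : Fin (n + 1)))
    rw [add_sub_cancel_right] at this
    rw [this]
  rw [← wordVal_rotate_iterate w j, Nat.mod_eq_of_lt hlt]

theorem le_wordVal_iff {q n a b : ℕ} (hab : a + b < q) (w : Fin (n + 2) → Fin q) :
    a * (q ^ (n + 1) + q ^ n) + b * q ^ n ≤ wordVal w ↔
      a < (w (Fin.last _) : ℕ) ∨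
        (w (Fin.last _) : ℕ) = a ∧ a + b ≤ (w (Fin.last n).castSucc : ℕ) := by
  set x := (w (Fin.last (n + 1)) : ℕ)
  set y := (w (Fin.last n).castSucc : ℕ)
  set r := wordVal fun i : Fin n => w i.castSucc.castSucc
  have hy : y < q := (w (Fin.last n).castSucc).2
  have hr : r < q ^ n := wordVal_lt _
  have hw : wordVal w = r + y * q ^ n + x * q ^ (n + 1) := by
    rw [wordVal, Fin.sum_univ_castSucc, Fin.sum_univ_castSucc]
    rfl
  rw [hw, pow_succ]
  set Q := q ^ n
  rw [show a * (Q * q + Q) + b * Q = Q * (a * q + (a + b)) by ring,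
    show r + y * Q + x * (Q * q) = r + Q * (x * q + y) by ring,
    ← Nat.lt_add_one_iff (m := Q * _)]
  have : Q * (a * q + (a + b)) < r + Q * (x * q + y) + 1 ↔ a * q + (a + b) ≤ x * q + y := by
    constructor
    · intro h
      by_contra! hc
      have := Nat.mul_le_mul_left Q (Nat.succ_le_of_lt hc)
      rw [Nat.succ_eq_add_one, mul_add Q _ 1] at this
      omega
    · intro h
      have := Nat.mul_le_mul_left Q h
      omega
  rw [this]
  rcases lt_trichotomy x a with h | h | h
  · have := Nat.mul_le_mul_right q (Nat.succ_le_of_lt h)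
    rw [Nat.succ_eq_add_one, add_mul] at this
    omega
  · subst h
    omega
  · have := Nat.mul_le_mul_right q (Nat.succ_le_of_lt h)
    rw [Nat.succ_eq_add_one, add_mul] at this
    omega

open Fin.NatCast Fin.CommRing in
open scoped Classical in
theorem card_residues_eq_card_words {q n a b : ℕ} (hq : Odd q) (hab : a + b < q) :
    ((range (q ^ (n + 2) - 1)).filter fun s => Odd s ∧
      ∀ j, a * (q ^ (n + 1) + q ^ n) + b * q ^ n ≤ s * q ^ j % (q ^ (n + 2) - 1)).card =
    (univ.filter fun w : Fin (n + 2) → Fin q => Odd (∑ i, (w i : ℕ)) ∧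
      ∀ i, a < (w (i + 1) : ℕ) ∨ (w (i + 1) : ℕ) = a ∧ a + b ≤ w i).card := by
  have hiff : ∀ w : Fin (n + 2) → Fin q, wordVal w < q ^ (n + 2) - 1 →
      ((∀ j, a * (q ^ (n + 1) + q ^ n) + b * q ^ n ≤ wordVal w * q ^ j % (q ^ (n + 2) - 1)) ↔
      ∀ i, a < (w (i + 1) : ℕ) ∨ (w (i + 1) : ℕ) = a ∧ a + b ≤ w i) := by
    intro w hw
    have hidx : (Fin.last n).castSucc + 1 = Fin.last (n + 1) := by simp
    simp only [wordVal_rotate_mod hw, le_wordVal_iff hab, ← hidx]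
    constructor
    · intro h i
      have := h ((Fin.last n).castSucc - i : Fin (n + 2))
      rw [Fin.cast_val_eq_self] at this
      convert this using 5 <;> ring
    · intro h j
      have := h ((Fin.last n).castSucc - j)
      convert this using 5 <;> ring
  symm
  apply card_bij (fun w _ => wordVal w)
  · intro w hw
    obtain ⟨-, hodd, hadm⟩ := mem_filter.1 hw
    rw [← odd_wordVal hq] at hodd
    have hlt : wordVal w < q ^ (n + 2) - 1 := by
      have h1 := wordVal_lt w
      have h2 : Odd (q ^ (n + 2)) := hq.pow
      obtain ⟨c, hc⟩ := h2
      obtain ⟨d, hd⟩ := hodd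
      omega
    exact mem_filter.2 ⟨mem_range.2 hlt, hodd, (hiff w hlt).2 hadm⟩
  · intro w _ v _ h
    exact wordVal_injective _ _ h
  · intro s hs
    obtain ⟨hlt, hodd, hadm⟩ := mem_filter.1 hs
    have hlt := mem_range.1 hlt
    obtain ⟨w, rfl⟩ := exists_wordVal_eq (hlt.trans_le (Nat.sub_le _ _))
    exact ⟨w, mem_filter.2 ⟨mem_univ _, (odd_wordVal hq w).1 hodd, (hiff w hlt).1 hadm⟩, rfl⟩

theorem two_mul_card_odd_words {q n a b : ℕ} (hb : 1 ≤ b) (hab : a + b < q) :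
    2 * ((univ.filter fun w : Fin (n + 2) → Fin q => Odd (∑ i, (w i : ℕ)) ∧
      ∀ i, a < (w (i + 1) : ℕ) ∨ (w (i + 1) : ℕ) = a ∧ a + b ≤ w i).card : ℤ) =
    ∑ t ∈ range ((n + 2) / 2 + 1),
      (((n + 2) * (n + 2 - t).choose t / (n + 2 - t) : ℕ) : ℤ) *
        (((q - (a + 1) : ℕ) : ℤ) ^ (n + 2 - 2 * t) * ((q - (a + b) : ℕ) : ℤ) ^ t -
          (∑ y ∈ Ico (a + 1) q, (-1) ^ y) ^ (n + 2 - 2 * t) *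
            ((-1) ^ a * ∑ y ∈ Ico (a + b) q, (-1) ^ y) ^ t) := by
  have h1 := sum_admissible_words (R := ℤ) hb (show a < q by omega) (fun _ => 1) n
  have h2 := sum_admissible_words (R := ℤ) hb (show a < q by omega) (fun y => (-1) ^ y) n
  simp only [mul_sub, sum_sub_distrib, ← mul_assoc]
  simp only [mul_assoc] at h1 h2 ⊢
  simp only [sum_const, Nat.card_Ico, nsmul_eq_mul, mul_one, one_mul] at h1
  rw [← h1, ← h2, ← sum_sub_distrib, card_filter]
  push_cast
  rw [mul_sum]
  refine sum_congr rfl fun w _ => ?_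
  rw [prod_pow_eq_pow_sum]
  by_cases hw : ∀ i, a < (w (i + 1) : ℕ) ∨ (w (i + 1) : ℕ) = a ∧ a + b ≤ w i
  · by_cases ho : Odd (∑ i, (w i : ℕ))
    · rw [if_pos ⟨ho, hw⟩, if_pos hw, if_pos hw, ho.neg_one_pow]
      simp
    · rw [if_neg (fun h => ho h.1), if_pos hw, if_pos hw,
        (Nat.not_odd_iff_even.1 ho).neg_one_pow]
      simp
  · rw [if_neg (fun h => hw h.2), if_neg hw, if_neg hw]
    simp

theorem sum_Ico_neg_one_pow {q c : ℕ} (hq : Odd q) (hc : c ≤ q) :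
    ∑ y ∈ Ico c q, (-1 : ℤ) ^ y = ((q - c + 1) / 2 : ℕ) - ((q - c) / 2 : ℕ) := by
  obtain ⟨d, rfl⟩ := Nat.exists_eq_add_of_le hc
  induction d generalizing c with
  | zero => simp
  | succ d ih =>
    rw [sum_eq_sum_Ico_succ_bot (by omega), show c + (d + 1) = c + 1 + d by ring,
      ih (by rwa [show c + 1 + d = c + (d + 1) by ring]) (by omega)]
    rw [show c + 1 + d - (c + 1) = d by omega, show c + 1 + d - c = d + 1 by omega]
    rcases Nat.even_or_odd c with h | h
    · rw [h.neg_one_pow]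
      have : Odd (d + 1) := by
        rw [Nat.odd_add] at hq
        by_contra h'
        exact (Nat.not_odd_iff_even.2 h) (hq.2 (Nat.not_odd_iff_even.1 h'))
      obtain ⟨e, he⟩ := this
      omega
    · rw [h.neg_one_pow]
      have : Even (d + 1) := by
        rw [Nat.odd_add] at hq
        exact hq.1 h
      obtain ⟨e, he⟩ := this
      omega

open scoped Classical in
/-- If `B` is odd and the strict leader of a full-size `q`-cyclotomic coset, then the odd residues
whose coset is bounded below by `B` are those bounded below by `B + 1` and the coset of `B`. -/
theorem card_filter_leader {q N m B : ℕ} (hm : 0 < m) (hqm : q ^ m ≡ 1 [MOD N]) (hN : Even N)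
    (hq : Odd q) (hBN : B < N) (hB : Odd B) (hlead : ∀ d, 0 < d → d < m → B < B * q ^ d % N) :
    ((range N).filter fun s => Odd s ∧ ∀ j, B ≤ s * q ^ j % N).card =
      ((range N).filter fun s => Odd s ∧ ∀ j, B + 1 ≤ s * q ^ j % N).card + m := by
  have hodd : ∀ s j, Odd s → Odd (s * q ^ j % N) := by
    intro s j hs
    have h := hs.mul (hq.pow (n := j))
    rw [Nat.odd_iff] at h ⊢
    rw [Nat.mod_mod_of_dvd _ hN.two_dvd, h]
  have hper : ∀ s j e, e * m ≤ j → s * q ^ j ≡ s * q ^ (j - e * m) [MOD N] := by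
    intro s j e h
    have := ((hqm.pow e).mul_left (s * q ^ (j - e * m)))
    rwa [one_pow, mul_one, mul_assoc, ← pow_mul, mul_comm m e, ← pow_add, Nat.sub_add_cancel h]
      at this
  have hmodm : ∀ s j, s * q ^ j % N = s * q ^ (j % m) % N := by
    intro s j
    have := hper s j (j / m) (Nat.div_mul_le_self j m)
    rwa [show j - j / m * m = j % m by rw [mul_comm]; exact (Nat.mod_eq_sub_mul_div).symm] at this
  have hcomp : ∀ s i j, s * q ^ i % N * q ^ j % N = s * q ^ (i + j) % N := by
    intro s i j
    rw [pow_add, ← mul_assoc]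
    exact (Nat.mod_modEq _ _).mul_right _
  have hmin : ∀ j, B ≤ B * q ^ j % N := by
    intro j
    rw [hmodm]
    rcases Nat.eq_zero_or_pos (j % m) with h | h
    · rw [h, pow_zero, mul_one, Nat.mod_eq_of_lt hBN]
    · exact (hlead _ h (Nat.mod_lt _ hm)).le
  have hunion : ((range N).filter fun s => Odd s ∧ ∀ j, B ≤ s * q ^ j % N) =
      ((range N).filter fun s => Odd s ∧ ∀ j, B + 1 ≤ s * q ^ j % N) ∪
        (range m).image fun d => B * q ^ d % N := by
    ext s
    simp only [mem_union, mem_filter, mem_range, mem_image]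
    constructor
    · rintro ⟨hs, hso, hj⟩
      by_cases h : ∀ j, B + 1 ≤ s * q ^ j % N
      · exact Or.inl ⟨hs, hso, h⟩
      · push Not at h
        obtain ⟨j, hlt⟩ := h
        have heq : s * q ^ j % N = B := le_antisymm (Nat.lt_succ_iff.1 hlt) (hj j)
        refine Or.inr ⟨(m - j % m) % m, Nat.mod_lt _ hm, ?_⟩
        rw [← hmodm, ← heq, hmodm s j, hcomp, Nat.add_sub_cancel' (Nat.mod_lt _ hm).le, hmodm,
          Nat.mod_self, pow_zero, mul_one, Nat.mod_eq_of_lt hs]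
    · rintro (⟨hs, hso, hj⟩ | ⟨d, hd, rfl⟩)
      · exact ⟨hs, hso, fun j => (Nat.le_succ B).trans (hj j)⟩
      · refine ⟨Nat.mod_lt _ (by omega), hodd _ _ hB, fun j => ?_⟩
        rw [hcomp]
        exact hmin _
  have hinj : Set.InjOn (fun d => B * q ^ d % N) (range m : Set ℕ) := by
    have aux : ∀ d e, d < e → e < m → B * q ^ d % N ≠ B * q ^ e % N := by
      intro d e hde he h
      have h' := congrArg (fun x => x * q ^ (m - e) % N) h
      simp only [hcomp] at h'
      rw [Nat.add_sub_cancel' he.le, hmodm B m, Nat.mod_self, pow_zero, mul_one,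
        Nat.mod_eq_of_lt hBN] at h'
      exact (hlead (d + (m - e)) (by omega) (by omega)).ne' h'
    intro d hd e he h
    have hd := mem_range.1 hd
    have he := mem_range.1 he
    rcases lt_trichotomy d e with hde | hde | hde
    · exact absurd h (aux d e hde he)
    · exact hde
    · exact absurd h.symm (aux e d hde hd)
  rw [hunion, card_union_of_disjoint, card_image_of_injOn hinj, card_range]
  rw [disjoint_left]
  intro s hs hs'
  obtain ⟨d, hd, rfl⟩ := mem_image.1 hs'
  have hd := mem_range.1 hd
  have := (mem_filter.1 hs).2.2 (m - d)
  rw [hcomp, Nat.add_sub_cancel' hd.le, hmodm, Nat.mod_self, pow_zero, mul_one,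
    Nat.mod_eq_of_lt hBN] at this
  omega

/-- `B = a q^(n+1) + (a + b) q^n - 1` is the strict leader of its coset. -/
theorem lt_mul_pow_mod {q n a b B d : ℕ} (hn : 2 ≤ n) (hb : 2 ≤ b) (hab : a + b < q)
    (hB : B + 1 = a * (q ^ (n + 1) + q ^ n) + b * q ^ n) (hd0 : 0 < d) (hd : d < n + 2) :
    B < B * q ^ d % (q ^ (n + 2) - 1) := by
  have hq : 2 < q := by omega
  obtain ⟨N, hN⟩ : ∃ N, q ^ (n + 2) = N + 1 :=
    ⟨q ^ (n + 2) - 1, by have := Nat.one_le_pow (n + 2) q (by omega); omega⟩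
  rw [hN, Nat.add_sub_cancel]
  have hmod : ∀ v k, B < v → v < N → B * q ^ d = v + N * k → B < B * q ^ d % N := by
    intro v k h1 h2 h3
    rwa [h3, Nat.add_mul_mod_self_left, Nat.mod_eq_of_lt h2]
  have hNQ : N + 1 = q ^ n * q ^ 2 := by rw [← hN, pow_add]
  have hBQ : B + 1 = q ^ n * (a * q + (a + b)) := by rw [hB]; ring
  have hqQ : q ^ 2 ≤ q ^ n := Nat.pow_le_pow_right (by omega) hn
  obtain ⟨c, hc⟩ : ∃ c, q ^ 2 = c + 1 + (a * q + (a + b)) := by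
    have : a * q + (a + b) < q ^ 2 := by nlinarith
    exact ⟨q ^ 2 - (a * q + (a + b)) - 1, by omega⟩
  rcases d with _ | _ | e
  · omega
  · have hle : q ≤ (a + b) * q * q ^ n + a := by nlinarith
    obtain ⟨v, hv⟩ := Nat.exists_eq_add_of_le hle
    have h1 : (B + 1) * q = (N + 1) * a + (a + b) * q * q ^ n := by rw [hBQ, hNQ]; ring
    refine hmod v a ?_ ?_ ?_
    · zify at *
      nlinarith
    · zify at *
      nlinarith
    · rw [zero_add, pow_one]
      zify at *
      linarith
  · set Q := q ^ n
    have hlt : q ^ e < Q := Nat.pow_lt_pow_right (by omega) (by omega)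
    have hlt' : q ^ e * (c + 1) < Q * (c + 1) := Nat.mul_lt_mul_of_pos_right hlt (by omega)
    have hpos : 0 < q ^ e := Nat.pow_pos (by omega)
    have hsum : N + 1 = Q * (c + 1) + (B + 1) := by rw [hNQ, hBQ, hc]; ring
    have hle : q ^ e * (c + 1) ≤ N := by omega
    obtain ⟨k, hk⟩ : ∃ k, q ^ e * (a * q + (a + b)) = k + 1 := by
      refine ⟨q ^ e * (a * q + (a + b)) - 1, ?_⟩
      have : 0 < q ^ e * (a * q + (a + b)) := Nat.mul_pos hpos (by omega)
      omega
    refine hmod (N - q ^ e * (c + 1)) k (by omega) ?_ ?_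
    · have : 0 < q ^ e * (c + 1) := Nat.mul_pos hpos (by omega)
      omega
    · have h1 : (B + 1) * q ^ (e + 2) = (N + 1) * (k + 1) := by
        rw [hBQ, hNQ, ← hk]; ring
      have h2 : q ^ (e + 2) = q ^ e * (c + 1) + (k + 1) := by
        rw [← hk, ← mul_add, ← hc, pow_add]
      zify [hle] at h1 h2 ⊢
      linarith

/-- The closed form for the number of odd admissible words, as a sum over domino coverings. -/
theorem card_odd_words_eq_sum {q n a b : ℕ} (hq : Odd q) (hn : Even n) (hb : 1 ≤ b)
    (hab : a + b < q) :
    (univ.filter fun w : Fin (n + 2) → Fin q => Odd (∑ i, (w i : ℕ)) ∧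
      ∀ i, a < (w (i + 1) : ℕ) ∨ (w (i + 1) : ℕ) = a ∧ a + b ≤ (w i : ℕ)).card =
    ∑ t ∈ range ((n + 2) / 2 + 1), (n + 2) * (n + 2 - t).choose t / (n + 2 - t) *
      ∑ j ∈ range (t + 1),
        t.choose j * ((q - a - b) / 2) ^ j * ((q - a - b + 1) / 2) ^ (t - j) *
          (if (if Odd a then (t + j) % 2 = 1 else j % 2 = 1) then
            ∑ i ∈ range ((n + 2) / 2 - t + 1),
              (n + 2 - 2 * t).choose (2 * i) * ((q - a - 1) / 2) ^ (2 * i) *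
                ((q - a) / 2) ^ (n + 2 - 2 * t - 2 * i)
          else
            ∑ i ∈ range ((n + 2) / 2 - t),
              (n + 2 - 2 * t).choose (2 * i + 1) * ((q - a - 1) / 2) ^ (2 * i + 1) *
                ((q - a) / 2) ^ (n + 2 - 2 * t - 2 * i - 1)) := by
  have h2 : (2 : ℤ) ≠ 0 := by norm_num
  rw [← Nat.cast_inj (R := ℤ)]
  refine mul_left_cancel₀ h2 ?_
  rw [two_mul_card_odd_words hb hab, Nat.cast_sum, mul_sum _ _ (2 : ℤ)]
  refine sum_congr rfl fun t ht => ?_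
  obtain ⟨M, hM⟩ : ∃ M, (n + 2) / 2 = t + M :=
    Nat.exists_eq_add_of_le (Nat.lt_add_one_iff.mp (mem_range.mp ht))
  have hnt : n + 2 - 2 * t = 2 * M := by obtain ⟨r, rfl⟩ := hn; omega
  rw [hM, Nat.add_sub_cancel_left, hnt, Nat.cast_mul,
    mul_left_comm (2 : ℤ),
    two_mul_sum_parity a t _ _ (evenPart_add_oddPart _ _ M) (evenPart_sub_oddPart _ _ M),
    sum_Ico_neg_one_pow hq (by omega), sum_Ico_neg_one_pow hq (by omega)]
  have e1 : ((q - a - 1) / 2 : ℕ) + ((q - a) / 2 : ℕ) = q - (a + 1) := by omega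
  have e2 : ((q - a - b) / 2 : ℕ) + ((q - a - b + 1) / 2 : ℕ) = q - (a + b) := by omega
  rw [← Nat.cast_add, ← Nat.cast_add, e1, e2, show q - (a + 1) + 1 = q - a by omega,
    show q - (a + 1) = q - a - 1 by omega, show q - (a + b) = q - a - b by omega]

end Counting

theorem stmt_3 (q m a b n δt' δ k : ℕ)
    (hq : ∃ p e : ℕ, p.Prime ∧ Odd p ∧ 0 < e ∧ q = p ^ e)
    (hq3 : 3 ≤ q) (hm : 2 < m) (hme : Even m)
    (ha1 : 1 ≤ a) (hb1 : 1 ≤ b) (hab : a + b ≤ q - 1)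
    (hcond : 1 ≤ (q - a - 1) / 2)
    (hn : 2 * n = q ^ m - 1)
    (hδt : δt' = a * (q ^ (m - 1) + q ^ (m - 2)) + b * q ^ (m - 2) - 1)
    (hδ : δ = (δt' + 2) / 2)
    (hk : k = (∑ t ∈ Finset.range (m / 2 + 1),
      m * Nat.choose (m - t) t / (m - t) *
        ∑ j ∈ Finset.range (t + 1),
          Nat.choose t j * ((q - a - b) / 2) ^ j * ((q - a - b + 1) / 2) ^ (t - j) *
            (if (if Odd a then (t + j) % 2 = 1 else j % 2 = 1) then
              ∑ i ∈ Finset.range (m / 2 - t + 1),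
                Nat.choose (m - 2 * t) (2 * i) * ((q - a - 1) / 2) ^ (2 * i) *
                  ((q - a) / 2) ^ (m - 2 * t - 2 * i)
            else
              ∑ i ∈ Finset.range (m / 2 - t),
                Nat.choose (m - 2 * t) (2 * i + 1) * ((q - a - 1) / 2) ^ (2 * i + 1) *
                  ((q - a) / 2) ^ (m - 2 * t - 2 * i - 1))) + (if Even b then 1 else 0) * m)
    (F E : Type*) [Field F] [Fintype F] [Field E] [Algebra F E]
    (hF : Fintype.card F = q)
    (γ : E) (hγ : IsPrimitiveRoot γ (2 * n)) :
    (∀ c ∈ negaBCH F n γ δ 0, c ≠ 0 → δ ≤ hWt c) ∧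
    Module.finrank F (negaBCH F n γ δ 0) = k := by
  subst hF
  set q := Fintype.card F
  have hqo : Odd q := by
    obtain ⟨p, e, -, hp, -, hpe⟩ := hq
    rw [hpe]
    exact hp.pow
  obtain ⟨r, rfl⟩ : ∃ r, m = r + 2 := ⟨m - 2, by omega⟩
  have hr : Even r := by simpa [Nat.even_add] using hme
  have hr2 : 2 ≤ r := by obtain ⟨s, rfl⟩ := hr; omega
  have habq : a + b < q := by omega
  rw [show r + 2 - 1 = r + 1 by omega, Nat.add_sub_cancel] at hδt
  obtain ⟨A, hA⟩ : ∃ A, A = a * (q ^ (r + 1) + q ^ r) + b * q ^ r := ⟨_, rfl⟩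
  rw [← hA] at hδt
  have hQ : q ≤ q ^ r := Nat.le_self_pow (by omega) q
  have hA3 : 3 ≤ A := by
    calc 3 ≤ 0 + 1 * q ^ r := by omega
      _ ≤ A := hA ▸ Nat.add_le_add (Nat.zero_le _) (Nat.mul_le_mul_right _ hb1)
  have hApar : Even A ↔ Even b := by
    rw [hA, pow_succ]
    have : ¬ Even (q ^ r) := Nat.not_even_iff_odd.mpr hqo.pow
    have hqe : ¬ Even q := Nat.not_even_iff_odd.mpr hqo
    simp only [Nat.even_add, Nat.even_mul, this, hqe]
    tauto
  have hAlt : A < q ^ (r + 2) := by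
    have : A = q ^ r * (a * q + (a + b)) := by rw [hA]; ring
    rw [this, pow_add]
    exact Nat.mul_lt_mul_of_pos_left (by nlinarith) (by omega)
  have hδ2 : 2 ≤ δ := by omega
  have hqm : q ^ (r + 2) ≡ 1 [MOD 2 * n] := by
    rw [hn]
    exact ((Nat.modEq_iff_dvd' (by omega)).mpr dvd_rfl).symm
  refine ⟨fun c hc hc0 => le_hWt_of_mem_negaBCH hδ2 hγ hc hc0, ?_⟩
  classical
  rw [← card_odd_words_eq_sum hqo hr hb1 habq, ← card_residues_eq_card_words hqo habq,
    ← hn, ← hA] at hk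
  rw [finrank_negaBCH hδ2 (by omega) (by omega) hqo hqm hγ, hk]
  by_cases hbe : Even b
  · have hAe := hApar.mpr hbe
    have hB : 2 * δ - 1 + 1 = A := by obtain ⟨s, rfl⟩ := hAe; omega
    have hb2 : 2 ≤ b := by obtain ⟨s, rfl⟩ := hbe; omega
    rw [card_filter_leader (by omega) hqm (even_two_mul n) hqo (by omega)
      ⟨δ - 1, by omega⟩ fun d hd0 hd => by
        rw [hn]
        exact lt_mul_pow_mod hr2 hb2 habq (hB.trans hA) hd0 hd, hB, if_pos hbe, one_mul]
  · have hAo := Nat.not_even_iff_odd.mp (mt hApar.mp hbe)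
    have hB : 2 * δ - 1 = A := by obtain ⟨s, rfl⟩ := hAo; omega
    rw [hB, if_neg hbe, zero_mul, add_zero]
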